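/- Let Ω ⊂ ℂ be a bounded, open, connected, simply connected set. Let A = m(Ω) be its area, let L = H¹(∂Ω) be the one-dimensional Hausdorff measure of its boundary (assumed finite), and let ρ be the inradius of Ω. Then A ≤ 18 π ρ L. -/

import Mathlib

open MeasureTheory

/-- The inradius of a planar set: the supremum of radii of open discs contained in it. -/
noncomputable def inradius (Ω : Set ℂ) : ℝ :=
  sSup {r : ℝ | ∃ z : ℂ, Metric.ball z r ⊆ Ω}

open Metric Set

/-- A circle around a point outside a simply connected open set is not contained in this set. -/
theorem IsSimplyConnected.not_sphere_subset {Ω : Set ℂ} (hsc : IsSimplyConnected Ω)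
    (hopen : IsOpen Ω) {x : ℂ} (hx : x ∉ Ω) {t : ℝ} (ht : 0 < t) : ¬ sphere x t ⊆ Ω := by
  intro hsub
  obtain ⟨f, hfc, hf⟩ := Complex.exists_continuousOn_eqOn_exp_comp hsc hopen
    (g := fun z => z - x) (by fun_prop) (by
      rintro ⟨z, hz, hzx⟩
      exact hx (sub_eq_zero.1 hzx ▸ hz))
  have hmem : ∀ θ, circleMap x t θ ∈ Ω := fun θ => hsub (circleMap_mem_sphere x ht.le θ)
  have hexp : ∀ θ, Complex.exp (f (circleMap x t θ)) = t * Complex.exp (θ * Complex.I) := by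
    intro θ
    have := hf (hmem θ)
    simpa [circleMap] using this
  have heq : (fun θ : ℝ => f (circleMap x t θ)) =
      fun θ : ℝ => f (circleMap x t 0) + θ * Complex.I := by
    refine Complex.isCoveringMap_exp.eq_of_comp_eq
      (hfc.comp_continuous (continuous_circleMap x t) hmem) (by fun_prop) ?_ 0 (by simp)
    funext θ
    ext1
    simp only [Function.comp_apply, Complex.exp_add, hexp]
    simp
  have h2 := congrFun heq (2 * Real.pi)
  have h3 : circleMap x t (2 * Real.pi) = circleMap x t 0 := by simp [circleMap]
  simp [h3, Real.pi_ne_zero] at h2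

theorem le_of_ball_subset_ball {z x : ℂ} {r t : ℝ} (ht : 0 ≤ t) (h : ball z r ⊆ ball x t) :
    r ≤ t := by
  rcases le_or_gt r 0 with hr | hr
  · exact hr.trans ht
  · have := diam_mono h isBounded_ball
    rw [diam_ball_eq z hr.le, diam_ball_eq x ht] at this
    linarith

theorem bddAbove_radii {Ω : Set ℂ} (hbdd : Bornology.IsBounded Ω) :
    BddAbove {r : ℝ | ∃ z : ℂ, ball z r ⊆ Ω} := by
  obtain ⟨R, hR, hΩ⟩ := hbdd.subset_ball_lt 0 0
  exact ⟨R, fun r ⟨z, hz⟩ => le_of_ball_subset_ball hR.le (hz.trans hΩ)⟩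

theorem le_inradius {Ω : Set ℂ} (hbdd : Bornology.IsBounded Ω) {z : ℂ} {r : ℝ}
    (h : ball z r ⊆ Ω) : r ≤ inradius Ω :=
  le_csSup (bddAbove_radii hbdd) ⟨z, h⟩

theorem exists_ball_subset_of_lt_inradius {Ω : Set ℂ} {t : ℝ} (ht : t < inradius Ω) :
    ∃ z : ℂ, ∃ r, t < r ∧ ball z r ⊆ Ω := by
  obtain ⟨r, ⟨z, hz⟩, hr⟩ := exists_lt_of_lt_csSup
    (s := {r : ℝ | ∃ z : ℂ, ball z r ⊆ Ω}) ⟨0, 0, by simp⟩ ht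
  exact ⟨z, r, hr, hz⟩

theorem exists_mem_frontier_dist_le_inradius {Ω : Set ℂ} (hopen : IsOpen Ω)
    (hbdd : Bornology.IsBounded Ω) {z : ℂ} (hz : z ∈ Ω) :
    ∃ y ∈ frontier Ω, dist z y ≤ inradius Ω := by
  have hne : Ωᶜ.Nonempty := by
    rw [nonempty_compl]
    rintro rfl
    exact NormedSpace.unbounded_univ ℝ ℂ hbdd
  obtain ⟨y, hy, hdist⟩ := hopen.isClosed_compl.exists_infDist_eq_dist hne z
  have hball : ball z (dist z y) ⊆ Ω := hdist ▸ ball_infDist_compl_subset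
  refine ⟨y, ?_, le_inradius hbdd hball⟩
  rw [hopen.frontier_eq]
  refine ⟨closure_mono hball ?_, hy⟩
  rw [closure_ball z (dist_ne_zero.2 (ne_of_mem_of_not_mem hz hy))]
  simp [dist_comm]

/-- Small circles centred on the boundary of a bounded simply connected domain meet the
boundary. -/
theorem sphere_inter_frontier_nonempty {Ω : Set ℂ} (hopen : IsOpen Ω)
    (hsc : IsSimplyConnected Ω) {x : ℂ} (hx : x ∈ frontier Ω) {t : ℝ} (ht : 0 < t)
    (htρ : t < inradius Ω) : (sphere x t ∩ frontier Ω).Nonempty := by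
  by_contra hemp
  have hxΩ : x ∈ closure Ω \ Ω := hopen.frontier_eq ▸ hx
  have hdisj : sphere x t ∩ Ω = ∅ := by
    by_contra hne
    refine hsc.not_sphere_subset hopen hxΩ.2 ht ?_
    refine (isPreconnected_sphere (by simp) x t).subset_of_closure_inter_subset
      hopen (nonempty_iff_ne_empty.2 hne) ?_
    rintro y ⟨hy, hys⟩
    by_contra hyΩ
    exact hemp ⟨y, hys, hopen.frontier_eq ▸ ⟨hy, hyΩ⟩⟩
  have hsub : Ω ⊆ ball x t := by
    refine hsc.isPathConnected.isConnected.isPreconnected.subset_of_closure_inter_subset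
      isOpen_ball ?_ ?_
    · obtain ⟨y, hy, hyΩ⟩ := mem_closure_iff.1 hxΩ.1 _ isOpen_ball (mem_ball_self ht)
      exact ⟨y, hyΩ, hy⟩
    · rintro y ⟨hy, hyΩ⟩
      refine lt_of_le_of_ne (mem_closedBall.1 (closure_ball_subset_closedBall hy)) fun h => ?_
      exact (hdisj ▸ (⟨h, hyΩ⟩ : y ∈ sphere x t ∩ Ω) : y ∈ (∅ : Set ℂ))
  obtain ⟨z, r, htr, hz⟩ := exists_ball_subset_of_lt_inradius htρ
  exact htr.not_ge (le_of_ball_subset_ball ht.le (hz.trans hsub))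

theorem inradius_le_hausdorffMeasure_frontier_inter_ball {Ω : Set ℂ} (hopen : IsOpen Ω)
    (hsc : IsSimplyConnected Ω) {x : ℂ} (hx : x ∈ frontier Ω) :
    ENNReal.ofReal (inradius Ω) ≤
      Measure.hausdorffMeasure 1 (frontier Ω ∩ ball x (inradius Ω)) := by
  have hsub : Ioo 0 (inradius Ω) ⊆
      (fun y => dist y x) '' (frontier Ω ∩ ball x (inradius Ω)) := by
    rintro t ⟨ht, htρ⟩
    obtain ⟨y, hys, hy⟩ := sphere_inter_frontier_nonempty hopen hsc hx ht htρ
    exact ⟨y, ⟨hy, (mem_sphere.1 hys).trans_lt htρ⟩, hys⟩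
  calc ENNReal.ofReal (inradius Ω) = Measure.hausdorffMeasure 1 (Ioo 0 (inradius Ω)) := by
        rw [hausdorffMeasure_real, Real.volume_Ioo, sub_zero]
    _ ≤ _ := measure_mono hsub
    _ ≤ _ := by
        simpa using (LipschitzWith.dist_left x).hausdorffMeasure_image_le zero_le_one
          (frontier Ω ∩ ball x (inradius Ω))

theorem volume_le_inradius_mul_hausdorffMeasure_frontier {Ω : Set ℂ} (hopen : IsOpen Ω)
    (hbdd : Bornology.IsBounded Ω) (hsc : IsSimplyConnected Ω) :
    volume Ω ≤ ENNReal.ofReal (9 * Real.pi * inradius Ω) *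
      Measure.hausdorffMeasure 1 (frontier Ω) := by
  set ρ := inradius Ω
  have hρ : 0 < ρ := by
    obtain ⟨z, hz⟩ := hsc.nonempty
    obtain ⟨r, hr, hball⟩ := isOpen_iff.1 hopen z hz
    exact hr.trans_le (le_inradius hbdd hball)
  obtain ⟨u, hu, hdisj, hcov⟩ := Vitali.exists_disjoint_subfamily_covering_enlargement
    (fun x : ℂ => ball x ρ) (frontier Ω) (fun _ => 1) 2 one_lt_two (by simp) 1 (by simp)
    (fun x _ => nonempty_ball.2 hρ)
  have hcount : u.Countable :=
    hdisj.countable_of_isOpen (fun _ _ => isOpen_ball) fun x _ => nonempty_ball.2 hρ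
  have hΩ : Ω ⊆ ⋃ b ∈ u, ball b (3 * ρ) := by
    intro z hz
    obtain ⟨y, hy, hzy⟩ := exists_mem_frontier_dist_le_inradius hopen hbdd hz
    obtain ⟨b, hb, ⟨w, hwy, hwb⟩, -⟩ := hcov y hy
    refine mem_iUnion₂.2 ⟨b, hb, ?_⟩
    rw [mem_ball] at *
    have h1 := dist_triangle4 z y w b
    rw [dist_comm y w] at h1
    linarith
  have hvol : ∀ b : ℂ, volume (ball b (3 * ρ)) =
      ENNReal.ofReal (9 * Real.pi * ρ) * ENNReal.ofReal ρ := by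
    intro b
    rw [Complex.volume_ball, ← ENNReal.ofReal_pow (by positivity),
      ← ENNReal.ofReal_coe_nnreal, ← ENNReal.ofReal_mul (by positivity),
      ← ENNReal.ofReal_mul (by positivity), NNReal.coe_real_pi]
    ring_nf
  calc volume Ω ≤ ∑' b : u, volume (ball (b : ℂ) (3 * ρ)) :=
        (measure_mono hΩ).trans (measure_biUnion_le volume hcount _)
    _ = ENNReal.ofReal (9 * Real.pi * ρ) * ∑' _ : u, ENNReal.ofReal ρ := by
        simp_rw [hvol, ENNReal.tsum_mul_left]
    _ ≤ ENNReal.ofReal (9 * Real.pi * ρ) *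
          ∑' b : u, Measure.hausdorffMeasure 1 (frontier Ω ∩ ball (b : ℂ) ρ) := by
        gcongr with b
        exact inradius_le_hausdorffMeasure_frontier_inter_ball hopen hsc (hu b.2)
    _ = ENNReal.ofReal (9 * Real.pi * ρ) *
          Measure.hausdorffMeasure 1 (⋃ b ∈ u, frontier Ω ∩ ball b ρ) := by
        rw [measure_biUnion hcount (hdisj.mono fun _ => inter_subset_right)
          fun _ _ => isClosed_frontier.measurableSet.inter measurableSet_ball]
    _ ≤ _ := by
        gcongr
        exact iUnion₂_subset fun _ _ => inter_subset_left

/-- For a bounded simply connected planar domain `Ω` with boundary of finite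
one-dimensional Hausdorff measure, `area(Ω) ≤ 18 π ρ(Ω) H¹(∂Ω)`. -/
theorem area_le_inradius_mul_perimeter (Ω : Set ℂ) (hopen : IsOpen Ω)
    (hbdd : Bornology.IsBounded Ω) (hconn : IsConnected Ω)
    (hsc : SimplyConnectedSpace Ω)
    (hfin : Measure.hausdorffMeasure 1 (frontier Ω) < ⊤) :
    (volume Ω).toReal ≤
      18 * Real.pi * inradius Ω * (Measure.hausdorffMeasure 1 (frontier Ω)).toReal := by
  have hρ : 0 ≤ inradius Ω := le_inradius hbdd (z := 0) (by simp)
  have h := ENNReal.toReal_mono (ENNReal.mul_ne_top ENNReal.ofReal_ne_top hfin.ne)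
    (volume_le_inradius_mul_hausdorffMeasure_frontier hopen hbdd hsc)
  rw [ENNReal.toReal_mul, ENNReal.toReal_ofReal (by positivity)] at h
  refine h.trans ?_
  gcongr
  norm_num
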